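/- For every x ∈ ℝ and every δ ≥ 0, one has δ·r(x+δ) ≤ Ψ(x+δ) − Ψ(x) − (1/2)(x+δ)² + (1/2)x² ≤ δ·r(x), where Ψ(x) = −log Φ̄(x) and r(x) = ρ(x) − x. Equivalently, exp(−δ r(x+δ)) ≥ exp(xδ + δ²/2)·Φ̄(x+δ)/Φ̄(x) ≥ exp(−δ r(x)). -/

import Mathlib

/-- Standard normal density. -/
noncomputable def stdPhi (x : ℝ) : ℝ := Real.exp (-x ^ 2 / 2) / Real.sqrt (2 * Real.pi)

/-- Standard normal upper-tail probability. -/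
noncomputable def phiBar (x : ℝ) : ℝ := ∫ t in Set.Ioi x, stdPhi t

/-- Standard normal hazard rate. -/
noncomputable def rho (x : ℝ) : ℝ := stdPhi x / phiBar x

/-- The difference r(x) = ρ(x) − x. -/
noncomputable def rFun (x : ℝ) : ℝ := rho x - x

/-- Ψ(x) = −log Φ̄(x). -/
noncomputable def Psi (x : ℝ) : ℝ := -Real.log (phiBar x)

open MeasureTheory Set Filter Topology

lemma stdPhi_pos (x : ℝ) : 0 < stdPhi x := by
  unfold stdPhi
  positivity

lemma integrable_stdPhi : Integrable stdPhi := by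
  have h := (integrable_exp_neg_mul_sq (b := 1 / 2) (by norm_num)).div_const
    (Real.sqrt (2 * Real.pi))
  refine h.congr (Eventually.of_forall fun t => ?_)
  simp only [stdPhi]
  ring_nf

lemma integrable_mul_stdPhi : Integrable fun t => t * stdPhi t := by
  have h := (integrable_mul_exp_neg_mul_sq (b := 1 / 2) (by norm_num)).div_const
    (Real.sqrt (2 * Real.pi))
  refine h.congr (Eventually.of_forall fun t => ?_)
  simp only [stdPhi]
  ring_nf

lemma hasDerivAt_stdPhi (t : ℝ) : HasDerivAt stdPhi (-(t * stdPhi t)) t := by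
  have h : HasDerivAt (fun t : ℝ => -t ^ 2 / 2) (-t) t := by
    convert! ((hasDerivAt_pow 2 t).neg.div_const 2) using 1
    norm_num
    ring
  convert! h.exp.div_const (Real.sqrt (2 * Real.pi)) using 1
  simp only [stdPhi]
  ring

lemma tendsto_stdPhi_atTop : Tendsto stdPhi atTop (𝓝 0) := by
  have h : Tendsto (fun t : ℝ => -t ^ 2 / 2) atTop atBot := by
    have h2 : Tendsto (fun t : ℝ => t ^ 2 / 2) atTop atTop :=
      (tendsto_pow_atTop two_ne_zero).atTop_div_const two_pos
    exact (tendsto_neg_atTop_atBot.comp h2).congr fun t => by simp [neg_div]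
  have h3 := (Real.tendsto_exp_atBot.comp h).div_const (Real.sqrt (2 * Real.pi))
  rwa [zero_div] at h3

lemma setIntegral_Ioi_mul_stdPhi (x : ℝ) : ∫ t in Ioi x, t * stdPhi t = stdPhi x := by
  have h := integral_Ioi_of_hasDerivAt_of_tendsto' (a := x)
    (fun t _ => hasDerivAt_stdPhi t) integrable_mul_stdPhi.neg.integrableOn tendsto_stdPhi_atTop
  rw [integral_neg] at h
  linarith

lemma phiBar_pos (x : ℝ) : 0 < phiBar x := by
  unfold phiBar
  rw [setIntegral_pos_iff_support_of_nonneg_ae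
    (Eventually.of_forall fun t => (stdPhi_pos t).le) integrable_stdPhi.integrableOn]
  have h : Function.support stdPhi = univ :=
    eq_univ_of_forall fun t => (stdPhi_pos t).ne'
  simp [h]

lemma phiBar_add (x h : ℝ) : phiBar (x + h) = ∫ t in Ioi x, stdPhi (t + h) := by
  have := (measurePreserving_add_right volume h).setIntegral_preimage_emb
    (measurableEmbedding_addRight h) stdPhi (Ioi (x + h))
  rw [phiBar, ← this]
  simp

/-- Tangent-line bound for the Gaussian density shifted by `h`. -/
lemma le_stdPhi_add (x h t : ℝ) :
    Real.exp (-(x * h) - h ^ 2 / 2 - h * rFun x) *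
      ((1 + h * rho x) * stdPhi t - h * (t * stdPhi t)) ≤ stdPhi (t + h) := by
  have hshift : stdPhi (t + h) = Real.exp (-(x * h) - h ^ 2 / 2 - h * rFun x) *
      (Real.exp (-h * (t - rho x)) * stdPhi t) := by
    simp only [stdPhi, rFun]
    rw [← mul_div_assoc, ← mul_div_assoc, ← Real.exp_add, ← Real.exp_add]
    ring_nf
  rw [hshift]
  refine mul_le_mul_of_nonneg_left ?_ (Real.exp_pos _).le
  have := mul_le_mul_of_nonneg_right (Real.add_one_le_exp (-h * (t - rho x))) (stdPhi_pos t).le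
  linarith

lemma le_phiBar_add (x h : ℝ) :
    Real.exp (-(x * h) - h ^ 2 / 2 - h * rFun x) * phiBar x ≤ phiBar (x + h) := by
  have hφ := integrable_stdPhi.integrableOn (s := Ioi x)
  have hm := integrable_mul_stdPhi.integrableOn (s := Ioi x)
  have hmass : ∫ t in Ioi x, ((1 + h * rho x) * stdPhi t - h * (t * stdPhi t)) = phiBar x := by
    rw [integral_sub (hφ.const_mul _) (hm.const_mul _), integral_const_mul, integral_const_mul,
      setIntegral_Ioi_mul_stdPhi, ← phiBar, rho]
    field_simp [(phiBar_pos x).ne']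
    ring
  rw [phiBar_add, ← hmass, ← integral_const_mul]
  exact integral_mono (((hφ.const_mul _).sub (hm.const_mul _)).const_mul _)
    (integrable_stdPhi.comp_add_right h).integrableOn (le_stdPhi_add x h)

/-- The function `Ψ(x) - x² / 2` lies below its tangent lines. -/
lemma Psi_add_sub_le (x h : ℝ) :
    Psi (x + h) - Psi x - (x + h) ^ 2 / 2 + x ^ 2 / 2 ≤ h * rFun x := by
  have hlog := Real.log_le_log (mul_pos (Real.exp_pos _) (phiBar_pos x)) (le_phiBar_add x h)
  rw [Real.log_mul (Real.exp_pos _).ne' (phiBar_pos x).ne', Real.log_exp] at hlog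
  unfold Psi
  linarith

theorem Psi_increment_rFun_bounds (x δ : ℝ) (hδ : 0 ≤ δ) :
    δ * rFun (x + δ) ≤ Psi (x + δ) - Psi x - (x + δ) ^ 2 / 2 + x ^ 2 / 2 ∧
      Psi (x + δ) - Psi x - (x + δ) ^ 2 / 2 + x ^ 2 / 2 ≤ δ * rFun x := by
  refine ⟨?_, Psi_add_sub_le x δ⟩
  have h := Psi_add_sub_le (x + δ) (-δ)
  rw [add_neg_cancel_right] at h
  linarith
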